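/- Let N be a normal subgroup of G and V a G-module. Then σ(G,V) ≤ σ(G/N) · σ(N,V), where V is regarded as an N-module by restriction. -/

import Mathlib

open scoped ENNReal


open MvPolynomial

/-- The (right) action of a group element `g` on the coordinate ring `F[V]` of `V = ι → F`,
determined by `(f^g)(v) = f (g • v)` where `g` acts on `V` through the representation `ρ`. -/
noncomputable def polyAct {F : Type*} [Field F] {G : Type*} [Group G] {ι : Type*}
    [Fintype ι] [DecidableEq ι] (ρ : Representation F G (ι → F)) (g : G) :
    MvPolynomial ι F →ₐ[F] MvPolynomial ι F :=
  MvPolynomial.aeval (fun i => ∑ j, (ρ g (Pi.single j 1) i) • MvPolynomial.X j)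

/-- The ring of polynomial invariants `F[V]^G`. -/
noncomputable def invRing {F : Type*} [Field F] {G : Type*} [Group G] {ι : Type*}
    [Fintype ι] [DecidableEq ι] (ρ : Representation F G (ι → F)) :
    Subalgebra F (MvPolynomial ι F) :=
  ⨅ g : G, AlgHom.equalizer (polyAct ρ g) (AlgHom.id F (MvPolynomial ι F))

/-- The degree `d` homogeneous component of a graded subalgebra `S` of the polynomial ring,
as a subspace of the polynomial ring. -/
noncomputable def subComp {F : Type*} [Field F] {ι : Type*} (S : Subalgebra F (MvPolynomial ι F)) (d : ℕ) :
    Submodule F (MvPolynomial ι F) :=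
  Subalgebra.toSubmodule S ⊓ homogeneousSubmodule ι F d

/-- `S_+`, the span of the homogeneous elements of positive degree of `S`. -/
noncomputable def subPos {F : Type*} [Field F] {ι : Type*} (S : Subalgebra F (MvPolynomial ι F)) :
    Submodule F (MvPolynomial ι F) :=
  ⨆ d ∈ Set.Ioi (0 : ℕ), subComp S d

/-- `β_k(S)`, the top degree of `S_+ / S_+^{k+1}`, i.e. the supremum (in `ℕ∞`) of the degrees `d`
such that the degree `d` component of `S_+` is not contained in `S_+^{k+1}`. -/
noncomputable def betaAlg {F : Type*} [Field F] {ι : Type*}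
    (S : Subalgebra F (MvPolynomial ι F)) (k : ℕ) : ℕ∞ :=
  sSup ((fun d : ℕ => (d : ℕ∞)) '' {d | 0 < d ∧ ¬ subComp S d ≤ subPos S ^ (k + 1)})

/-- `β_k(F[V], S)`, the top degree of `F[V]/S_+^k F[V]`, i.e. the supremum (in `ℕ∞`) of the
degrees `d` such that the degree `d` component of the polynomial ring is not contained in
`S_+^k ⬝ F[V]`. -/
noncomputable def betaMod {F : Type*} [Field F] {ι : Type*}
    (S : Subalgebra F (MvPolynomial ι F)) (k : ℕ) : ℕ∞ :=
  sSup ((fun d : ℕ => (d : ℕ∞)) ''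
    {d | ¬ homogeneousSubmodule ι F d ≤ subPos S ^ k * (⊤ : Submodule F (MvPolynomial ι F))})

/-- `β_k(G)`, the supremum over all finite dimensional `G`-modules `V` of `β_k(F[V]^G)`. -/
noncomputable def betaGrp (F : Type*) [Field F] (G : Type*) [Group G] (k : ℕ) : ℕ∞ :=
  ⨆ (n : ℕ) (ρ : Representation F G (Fin n → F)), betaAlg (invRing ρ) k

/-- `S` is a finitely generated module over its subalgebra `T`. -/
noncomputable def fgOver {F : Type*} [Field F] {ι : Type*} (S T : Subalgebra F (MvPolynomial ι F)) : Prop :=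
  ∃ B : Finset (MvPolynomial ι F), (B : Set (MvPolynomial ι F)) ⊆ S ∧
    Subalgebra.toSubmodule S ≤ Subalgebra.toSubmodule T * Submodule.span F (B : Set (MvPolynomial ι F))

/-- `σ(S)`: the minimal `d` such that `S` is a finitely generated module over the subalgebra
`F[S_{≤ d}]` generated by the homogeneous elements of `S` of degree at most `d`. -/
noncomputable def sigmaAlg {F : Type*} [Field F] {ι : Type*}
    (S : Subalgebra F (MvPolynomial ι F)) : ℕ :=
  sInf {d : ℕ | fgOver S (Algebra.adjoin F (⋃ i ∈ Set.Iic d, (subComp S i : Set (MvPolynomial ι F))))}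

/-- `σ(G)`, the supremum over all finite dimensional `G`-modules `V` of `σ(F[V]^G)`. -/
noncomputable def sigmaGrp (F : Type*) [Field F] (G : Type*) [Group G] : ℕ∞ :=
  ⨆ (n : ℕ) (ρ : Representation F G (Fin n → F)), (sigmaAlg (invRing ρ) : ℕ∞)

/-- An irreducible (simple, nonzero) representation. -/
def IsIrredRep {F : Type*} [Field F] {G : Type*} [Group G] {V : Type*}
    [AddCommGroup V] [Module F V] (π : Representation F G V) : Prop :=
  Nontrivial V ∧ ∀ W : Submodule F V, (∀ g : G, ∀ x ∈ W, π g x ∈ W) → W = ⊥ ∨ W = ⊤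

section Helpers

variable {F : Type*} [Field F] {ι : Type*}

/-- The subalgebra generated by homogeneous elements of degree at most `d`. -/
noncomputable def truncAlg (S : Subalgebra F (MvPolynomial ι F)) (d : ℕ) :
    Subalgebra F (MvPolynomial ι F) :=
  Algebra.adjoin F (⋃ i ∈ Set.Iic d, (subComp S i : Set (MvPolynomial ι F)))

lemma truncAlg_le (S : Subalgebra F (MvPolynomial ι F)) (d : ℕ) : truncAlg S d ≤ S := by
  refine Algebra.adjoin_le ?_
  intro x hx
  simp only [Set.mem_iUnion] at hx
  obtain ⟨i, _, hx⟩ := hx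
  exact hx.1

/-- Closed under homogeneous components. -/
def IsGr (S : Subalgebra F (MvPolynomial ι F)) : Prop :=
  ∀ f ∈ S, ∀ i, homogeneousComponent i f ∈ S

lemma mem_truncAlg {S : Subalgebra F (MvPolynomial ι F)} (hS : IsGr S) {d : ℕ}
    {f : MvPolynomial ι F} (hf : f ∈ S) (hd : f.totalDegree ≤ d) : f ∈ truncAlg S d := by
  rw [← sum_homogeneousComponent f]
  refine Subalgebra.sum_mem _ fun i hi => Algebra.subset_adjoin ?_
  simp only [Set.mem_iUnion]
  refine ⟨i, ?_, hS f hf i, homogeneousComponent_mem i f⟩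
  simp only [Finset.mem_range] at hi
  simp only [Set.mem_Iic]; omega

/-- View a subalgebra as an algebra over a smaller one. -/
def overAlg {A : Type*} [CommRing A] [Algebra F A] (S T : Subalgebra F A) (h : T ≤ S) :
    Subalgebra T A where
  carrier := S
  mul_mem' := S.mul_mem
  add_mem' := S.add_mem
  algebraMap_mem' := fun r => h r.2

lemma integral_mono {A : Type*} [CommRing A] [Algebra F A] {T T' : Subalgebra F A}
    (h : ∀ t ∈ T, IsIntegral T' t) {x : A} (hx : IsIntegral T x) : IsIntegral T' x := by
  refine isIntegral_trans (A := integralClosure T' A) x ?_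
  obtain ⟨p, hp, hpx⟩ := hx
  let f : T →+* integralClosure T' A :=
    { toFun := fun t => ⟨t.1, h t.1 t.2⟩
      map_one' := rfl
      map_mul' := fun _ _ => rfl
      map_zero' := rfl
      map_add' := fun _ _ => rfl }
  refine ⟨p.map f, hp.map f, ?_⟩
  rw [Polynomial.eval₂_map]
  exact hpx

lemma integral_of_le {A : Type*} [CommRing A] [Algebra F A] {T T' : Subalgebra F A}
    (h : T ≤ T') {x : A} (hx : IsIntegral T x) : IsIntegral T' x :=
  integral_mono (fun t ht => isIntegral_algebraMap (x := (⟨t, h ht⟩ : T'))) hx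

/-- the part of `A` integral over `T`, as an `F`-algebra. -/
noncomputable def intCl {A : Type*} [CommRing A] [Algebra F A] (T : Subalgebra F A) :
    Subalgebra F A where
  carrier := {x | IsIntegral T x}
  mul_mem' := fun h h' => IsIntegral.mul h h'
  add_mem' := fun h h' => IsIntegral.add h h'
  algebraMap_mem' := fun r => isIntegral_algebraMap (x := (algebraMap F T r))

lemma mem_intCl {A : Type*} [CommRing A] [Algebra F A] (T : Subalgebra F A) (x : A) :
    x ∈ intCl T ↔ IsIntegral T x := Iff.rfl

lemma integral_of_fgOver {S T : Subalgebra F (MvPolynomial ι F)} (hTS : T ≤ S)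
    (h : fgOver S T) {x : MvPolynomial ι F} (hx : x ∈ S) : IsIntegral T x := by
  obtain ⟨B, hBS, hB⟩ := h
  refine IsIntegral.of_mem_of_fg (overAlg S T hTS) ⟨B, ?_⟩ x hx
  apply le_antisymm
  · rw [Submodule.span_le]
    exact hBS
  · intro y hy
    have hy' : y ∈ Subalgebra.toSubmodule S := hy
    refine Submodule.mul_induction_on (hB hy') ?_ ?_
    · intro t ht b hb
      have h1 : b ∈ Submodule.span T (B : Set (MvPolynomial ι F)) :=
        Submodule.span_le_restrictScalars F T _ hb
      exact Submodule.smul_mem _ (⟨t, ht⟩ : T) h1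
    · intro a b ha hb
      exact Submodule.add_mem _ ha hb

lemma truncAlg_fg [Finite ι] (S : Subalgebra F (MvPolynomial ι F)) (d : ℕ) :
    (truncAlg S d).FG := by
  have hfg : ∀ i, ∃ B : Finset (MvPolynomial ι F), Submodule.span F (B : Set _) = subComp S i := by
    intro i
    have h1 : (homogeneousSubmodule ι F i).FG := homogeneousSubmodule_fg _ _ i
    have h2 : (subComp S i).FG := Submodule.FG.of_le h1 inf_le_right
    exact h2
  choose B hB using hfg
  classical
  refine ⟨(Finset.range (d+1)).biUnion B, ?_⟩
  apply le_antisymm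
  · refine Algebra.adjoin_le ?_
    intro x hx
    simp only [Finset.coe_biUnion, Set.mem_iUnion, Finset.coe_range, Set.mem_Iio] at hx
    obtain ⟨i, hi, hx⟩ := hx
    refine Algebra.subset_adjoin ?_
    simp only [Set.mem_iUnion]
    refine ⟨i, Nat.lt_succ_iff.1 hi, ?_⟩
    rw [SetLike.mem_coe, ← hB]
    exact Submodule.subset_span hx
  · refine Algebra.adjoin_le ?_
    intro x hx
    simp only [Set.mem_iUnion] at hx
    obtain ⟨i, hi, hx⟩ := hx
    rw [SetLike.mem_coe, ← hB] at hx
    refine (Submodule.span_le (p := Subalgebra.toSubmodule (Algebra.adjoin F _))).2 ?_ hx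
    intro y hy
    refine Algebra.subset_adjoin ?_
    simp only [Finset.coe_biUnion, Set.mem_iUnion, Finset.coe_range, Set.mem_Iio]
    exact ⟨i, Nat.lt_succ_iff.2 hi, hy⟩

lemma integral_all {T : Subalgebra F (MvPolynomial ι F)}
    (h : ∀ i, IsIntegral T (X i : MvPolynomial ι F)) (x : MvPolynomial ι F) : IsIntegral T x := by
  have : (⊤ : Subalgebra F (MvPolynomial ι F)) ≤ intCl T := by
    rw [← adjoin_range_X]
    refine Algebra.adjoin_le ?_
    rintro _ ⟨i, rfl⟩
    exact h i
  exact this (Algebra.mem_top (x := x))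

lemma fgOver_of_integral [Finite ι] (S : Subalgebra F (MvPolynomial ι F)) (d : ℕ)
    (h : ∀ i, IsIntegral (truncAlg S d) (X i : MvPolynomial ι F)) : fgOver S (truncAlg S d) := by
  have : IsNoetherianRing (truncAlg S d) := isNoetherianRing_of_fg (truncAlg_fg S d)
  have : Algebra.IsIntegral (truncAlg S d) (MvPolynomial ι F) := ⟨integral_all h⟩
  have : Algebra.FiniteType (truncAlg S d) (MvPolynomial ι F) :=
    Algebra.FiniteType.of_restrictScalars_finiteType F _ _
  have : Module.Finite (truncAlg S d) (MvPolynomial ι F) := Algebra.IsIntegral.finite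
  have hn : IsNoetherian (truncAlg S d) (MvPolynomial ι F) := inferInstance
  obtain ⟨B, hB⟩ := hn.noetherian
    (Subalgebra.toSubmodule (overAlg S (truncAlg S d) (truncAlg_le S d)))
  refine ⟨B, ?_, ?_⟩
  · intro x hx
    have h1 : x ∈ Submodule.span (truncAlg S d) (B : Set (MvPolynomial ι F)) :=
      Submodule.subset_span hx
    rw [hB] at h1
    exact h1
  · intro x hx
    have h1 : x ∈ Subalgebra.toSubmodule (overAlg S (truncAlg S d) (truncAlg_le S d)) := hx
    rw [← hB] at h1
    clear hx
    induction h1 using Submodule.span_induction with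
    | mem y hy =>
      rw [← one_mul y]
      exact Submodule.mul_mem_mul (one_mem (truncAlg S d)) (Submodule.subset_span hy)
    | zero => exact Submodule.zero_mem _
    | add a b ha hb iha ihb => exact Submodule.add_mem _ iha ihb
    | smul t a ha iha =>
      have h2 := Submodule.mul_mem_mul (M := Subalgebra.toSubmodule (truncAlg S d)) t.2 iha
      rw [← mul_assoc, (truncAlg S d).isIdempotentElem_toSubmodule.eq] at h2
      exact h2

lemma totalDegree_aeval_le' {κ : Type*} (u : κ → MvPolynomial ι F) (s : ℕ)
    (hu : ∀ k, (u k).totalDegree ≤ s) (p : MvPolynomial κ F) :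
    (aeval u p).totalDegree ≤ p.totalDegree * s := by
  rw [aeval_def, eval₂_eq]
  refine totalDegree_finsetSum_le fun m hm => ?_
  refine (totalDegree_mul _ _).trans ?_
  rw [algebraMap_eq, totalDegree_C, zero_add]
  refine (totalDegree_finsetProd _ _).trans ?_
  calc ∑ i ∈ m.support, (u i ^ m i).totalDegree ≤ ∑ i ∈ m.support, m i * s := by
        refine Finset.sum_le_sum fun i _ => (totalDegree_pow _ _).trans ?_
        exact Nat.mul_le_mul_left _ (hu i)
    _ = (m.sum fun _ e => e) * s := by rw [← Finset.sum_mul]; rfl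
    _ ≤ _ := Nat.mul_le_mul_right _ (le_totalDegree hm)

end Helpers

section Act

variable {F : Type*} [Field F] {G : Type*} [Group G] {ι : Type*}
    [Fintype ι] [DecidableEq ι] (ρ : Representation F G (ι → F))

lemma polyAct_X (g : G) (i : ι) :
    polyAct ρ g (X i) = ∑ j, (ρ g (Pi.single j 1) i) • (X j : MvPolynomial ι F) := by
  simp [polyAct]

lemma polyAct_one : polyAct ρ 1 = AlgHom.id F _ := by
  apply algHom_ext
  intro i
  rw [polyAct_X]
  simp [Pi.single_apply, Finset.sum_ite_eq, ite_smul]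

lemma polyAct_mul (g h : G) : polyAct ρ (g * h) = (polyAct ρ h).comp (polyAct ρ g) := by
  apply algHom_ext
  intro i
  rw [AlgHom.comp_apply, polyAct_X, polyAct_X, map_sum]
  simp_rw [map_smul, polyAct_X, Finset.smul_sum, smul_smul]
  rw [Finset.sum_comm]
  refine Finset.sum_congr rfl fun j _ => ?_
  rw [← Finset.sum_smul]
  congr 1
  rw [map_mul, Module.End.mul_apply, LinearMap.pi_apply_eq_sum_univ (ρ g), Finset.sum_apply]
  refine Finset.sum_congr rfl fun k _ => ?_
  rw [Pi.smul_apply, smul_eq_mul, mul_comm]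
  congr 1
  refine congrArg (fun v => ρ g v i) ?_
  funext l
  simp [Pi.single_apply, eq_comm]

lemma mem_invRing (f : MvPolynomial ι F) : f ∈ invRing ρ ↔ ∀ g, polyAct ρ g f = f := by
  simp [invRing, Algebra.mem_iInf, AlgHom.mem_equalizer]

lemma polyAct_homog (g : G) {f : MvPolynomial ι F} {d : ℕ} (hf : f.IsHomogeneous d) :
    (polyAct ρ g f).IsHomogeneous d := by
  have := IsHomogeneous.aeval (n := 1) hf
    (fun i => ∑ j, (ρ g (Pi.single j 1) i) • (X j : MvPolynomial ι F)) ?_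
  · rwa [one_mul] at this
  · intro i
    refine IsHomogeneous.sum _ _ _ fun j _ => ?_
    rw [smul_eq_C_mul]
    exact (isHomogeneous_X F j).C_mul _

lemma polyAct_comp (g : G) (f : MvPolynomial ι F) (i : ℕ) :
    homogeneousComponent i (polyAct ρ g f) = polyAct ρ g (homogeneousComponent i f) := by
  conv_lhs => rw [← sum_homogeneousComponent f, map_sum, map_sum]
  rw [Finset.sum_congr rfl fun j _ => homogeneousComponent_of_mem (m := i)
    (polyAct_homog ρ g (homogeneousComponent_isHomogeneous j f))]
  rw [Finset.sum_ite_eq]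
  split_ifs with h
  · rfl
  · rw [homogeneousComponent_eq_zero, map_zero]
    simp at h; omega

lemma invRing_gr : IsGr (invRing ρ) := by
  intro f hf i
  rw [mem_invRing] at hf ⊢
  intro g
  rw [← polyAct_comp, hf g]

lemma polyAct_deg (g : G) (f : MvPolynomial ι F) :
    (polyAct ρ g f).totalDegree ≤ f.totalDegree := by
  have := totalDegree_aeval_le' (fun i => ∑ j, (ρ g (Pi.single j 1) i) • (X j : MvPolynomial ι F))
    1 ?_ f
  · rwa [mul_one] at this
  · intro i
    refine totalDegree_finsetSum_le fun j _ => (totalDegree_smul_le _ _).trans ?_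
    simp

lemma integral_invRing [Finite G] (f : MvPolynomial ι F) : IsIntegral (invRing ρ) f := by
  have := Fintype.ofFinite G
  let P : Polynomial (MvPolynomial ι F) := ∏ g : G, (Polynomial.X - Polynomial.C (polyAct ρ g f))
  have hP : P.Monic := Polynomial.monic_prod_of_monic _ _ fun g _ => Polynomial.monic_X_sub_C _
  have hinv : ∀ h : G, P.map (polyAct ρ h : MvPolynomial ι F →+* MvPolynomial ι F) = P := by
    intro h
    simp only [P, Polynomial.map_prod]
    refine Fintype.prod_equiv (Equiv.mulRight h) _ _ fun g => ?_
    simp [polyAct_mul]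
  have hl : P ∈ Polynomial.lifts (algebraMap (invRing ρ) (MvPolynomial ι F)) := by
    rw [Polynomial.lifts_iff_coeff_lifts]
    intro n
    refine ⟨⟨P.coeff n, ?_⟩, rfl⟩
    rw [mem_invRing]
    intro g
    conv_rhs => rw [← hinv g]
    rw [Polynomial.coeff_map]; rfl
  obtain ⟨q, hq, -, hqm⟩ := Polynomial.lifts_and_natDegree_eq_and_monic hl hP
  refine ⟨q, hqm, ?_⟩
  rw [Polynomial.eval₂_eq_eval_map, hq]
  simp only [P, Polynomial.eval_prod]
  refine Finset.prod_eq_zero (Finset.mem_univ (1 : G)) ?_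
  simp [polyAct_one]

lemma exists_trunc_integral {F : Type*} [Field F] {ι : Type*} {S : Subalgebra F (MvPolynomial ι F)} (hS : IsGr S)
    {f : MvPolynomial ι F} (hf : IsIntegral S f) : ∃ d, ∀ e ≥ d, IsIntegral (truncAlg S e) f := by
  obtain ⟨p, hp, hpf⟩ := hf
  refine ⟨p.support.sup fun n => (p.coeff n).1.totalDegree, fun e he => ?_⟩
  have hl : p.map (algebraMap S (MvPolynomial ι F)) ∈
      Polynomial.lifts (algebraMap (truncAlg S e) (MvPolynomial ι F)) := by
    rw [Polynomial.lifts_iff_coeff_lifts]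
    intro n
    rw [Polynomial.coeff_map]
    refine ⟨⟨(p.coeff n).1, mem_truncAlg hS (p.coeff n).2 ?_⟩, rfl⟩
    by_cases hn : n ∈ p.support
    · exact (Finset.le_sup (f := fun n => (p.coeff n).1.totalDegree) hn).trans he
    · rw [Polynomial.notMem_support_iff.1 hn]; simp
  obtain ⟨q, hq, -, hqm⟩ := Polynomial.lifts_and_natDegree_eq_and_monic hl (hp.map _)
  refine ⟨q, hqm, ?_⟩
  rw [Polynomial.eval₂_eq_eval_map, hq, ← Polynomial.eval₂_eq_eval_map]
  exact hpf

lemma sigma_spec [Finite G] : fgOver (invRing ρ) (truncAlg (invRing ρ) (sigmaAlg (invRing ρ))) := by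
  refine Nat.sInf_mem (s := {d : ℕ | fgOver (invRing ρ) (truncAlg (invRing ρ) d)}) ?_
  choose d hd using fun i => exists_trunc_integral (invRing_gr ρ) (integral_invRing ρ (X i))
  refine ⟨Finset.univ.sup d, fgOver_of_integral _ _ fun i => hd i _ ?_⟩
  exact Finset.le_sup (Finset.mem_univ i)

lemma sigma_integral [Finite G] (f : MvPolynomial ι F) :
    IsIntegral (truncAlg (invRing ρ) (sigmaAlg (invRing ρ))) f :=
  integral_mono (fun _ ht => integral_of_fgOver (truncAlg_le _ _) (sigma_spec ρ) ht)
    (integral_invRing ρ f)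

lemma sigma_le (d : ℕ)
    (h : ∀ i, IsIntegral (truncAlg (invRing ρ) d) (X i : MvPolynomial ι F)) :
    sigmaAlg (invRing ρ) ≤ d :=
  Nat.sInf_le (fgOver_of_integral _ _ h)

end Act

section Main

variable {F : Type*} [Field F] {G : Type*} [Group G] (N : Subgroup G) [N.Normal]
    {ι : Type*} [Fintype ι] [DecidableEq ι] (ρ : Representation F G (ι → F)) (s : ℕ)

/-- `N`-invariants of degree at most `s`. -/
noncomputable def lowInv : Submodule F (MvPolynomial ι F) :=
  Subalgebra.toSubmodule (invRing (ρ.comp N.subtype)) ⊓ restrictTotalDegree ι F s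

lemma mem_lowInv (f : MvPolynomial ι F) : f ∈ lowInv N ρ s ↔
    (∀ n ∈ N, polyAct ρ n f = f) ∧ f.totalDegree ≤ s := by
  rw [lowInv, Submodule.mem_inf, mem_restrictTotalDegree, Subalgebra.mem_toSubmodule, mem_invRing]
  refine and_congr_left fun _ => ⟨fun h n hn => h ⟨n, hn⟩, fun h n => h n.1 n.2⟩

lemma polyAct_lowInv (g : G) (f : MvPolynomial ι F) (hf : f ∈ lowInv N ρ s) :
    polyAct ρ g f ∈ lowInv N ρ s := by
  rw [mem_lowInv] at hf ⊢
  refine ⟨fun n hn => ?_, (polyAct_deg ρ g f).trans hf.2⟩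
  have h1 : g * n = (g * n * g⁻¹) * g := by group
  rw [← AlgHom.comp_apply, ← polyAct_mul, h1, polyAct_mul, AlgHom.comp_apply,
    hf.1 _ (Subgroup.Normal.conj_mem ‹_› n hn g)]

/-- The action on `lowInv`. -/
noncomputable def lowAct (g : G) : lowInv N ρ s →ₗ[F] lowInv N ρ s :=
  (polyAct ρ g).toLinearMap.restrict (polyAct_lowInv N ρ s g)

lemma lowAct_coe (g : G) (u : lowInv N ρ s) : (lowAct N ρ s g u : MvPolynomial ι F) =
    polyAct ρ g u := rfl

lemma lowAct_one_of_mem (g : G) (hg : g ∈ N) : lowAct N ρ s g = LinearMap.id := by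
  ext1 u
  apply Subtype.ext
  rw [lowAct_coe]
  exact ((mem_lowInv N ρ s _).1 u.2).1 g hg

lemma lowAct_mul (g h : G) : lowAct N ρ s (g * h) = (lowAct N ρ s h).comp (lowAct N ρ s g) := by
  ext1 u
  apply Subtype.ext
  rw [LinearMap.comp_apply, lowAct_coe, lowAct_coe, lowAct_coe, polyAct_mul, AlgHom.comp_apply]

variable {n : ℕ} (b : Module.Basis (Fin n) F (lowInv N ρ s))

/-- The matrices of the dual action. -/
noncomputable def lowMat : G →* Matrix (Fin n) (Fin n) F where
  toFun g := (LinearMap.toMatrix b b (lowAct N ρ s g)).transpose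
  map_one' := by
    rw [lowAct_one_of_mem N ρ s 1 N.one_mem, LinearMap.toMatrix_id, Matrix.transpose_one]
  map_mul' g h := by
    rw [lowAct_mul, LinearMap.toMatrix_comp b b b, Matrix.transpose_mul]

/-- The `G/N`-module whose linear forms map onto `lowInv`. -/
noncomputable def lowRep : Representation F (G ⧸ N) (Fin n → F) :=
  ((Matrix.toLinAlgEquiv' : Matrix (Fin n) (Fin n) F ≃ₐ[F] _) :
    Matrix (Fin n) (Fin n) F →* ((Fin n → F) →ₗ[F] (Fin n → F))).comp
  (QuotientGroup.lift N (lowMat N ρ s b) (fun g hg => by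
    change (LinearMap.toMatrix b b (lowAct N ρ s g)).transpose = 1
    rw [lowAct_one_of_mem N ρ s g hg, LinearMap.toMatrix_id, Matrix.transpose_one]))

lemma lowRep_apply (g : G) (k j : Fin n) :
    lowRep N ρ s b (g : G ⧸ N) (Pi.single j 1) k = b.repr (lowAct N ρ s g (b k)) j := by
  change (Matrix.toLinAlgEquiv' (lowMat N ρ s b g)) (Pi.single j 1) k = _
  rw [Matrix.toLinAlgEquiv'_apply, Matrix.mulVec_single_one]
  change LinearMap.toMatrix b b (lowAct N ρ s g) j k = _
  rw [LinearMap.toMatrix_apply]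

/-- The substitution map. -/
noncomputable def lowMap : MvPolynomial (Fin n) F →ₐ[F] MvPolynomial ι F :=
  aeval fun k => (b k : MvPolynomial ι F)

lemma low_sum (u : lowInv N ρ s) :
    ∑ k, b.repr u k • (b k : MvPolynomial ι F) = (u : MvPolynomial ι F) := by
  have h := congrArg (lowInv N ρ s).subtype (b.sum_repr u)
  rw [map_sum] at h
  exact h

lemma lowMap_equiv (g : G) (p : MvPolynomial (Fin n) F) :
    lowMap N ρ s b (polyAct (lowRep N ρ s b) (g : G ⧸ N) p) = polyAct ρ g (lowMap N ρ s b p) := by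
  rw [← AlgHom.comp_apply, ← AlgHom.comp_apply]
  congr 1
  apply algHom_ext
  intro k
  rw [AlgHom.comp_apply, AlgHom.comp_apply, polyAct_X, map_sum]
  simp only [map_smul, lowMap, aeval_X]
  simp_rw [lowRep_apply]
  rw [← lowAct_coe]
  exact low_sum N ρ s b _

lemma main_bound [Finite G] (hs : s = sigmaAlg (invRing (ρ.comp N.subtype))) :
    sigmaAlg (invRing ρ) ≤ sigmaAlg (invRing (lowRep N ρ s b)) * s := by
  set q := sigmaAlg (invRing (lowRep N ρ s b)) with hq
  apply sigma_le
  have key : (truncAlg (invRing (lowRep N ρ s b)) q).map (lowMap N ρ s b) ≤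
      truncAlg (invRing ρ) (q * s) := by
    rw [Subalgebra.map_le]
    refine Algebra.adjoin_le ?_
    intro p hp
    simp only [Set.mem_iUnion] at hp
    obtain ⟨i, hi, hp1, hp2⟩ := hp
    refine mem_truncAlg (invRing_gr ρ) ?_ ?_
    · rw [mem_invRing]
      intro g
      change polyAct ρ g (lowMap N ρ s b p) = lowMap N ρ s b p
      rw [← lowMap_equiv, (mem_invRing _ p).1 hp1]
    · refine (totalDegree_aeval_le' _ s (fun k => ((mem_lowInv N ρ s _).1 (b k).2).2) p).trans ?_
      refine Nat.mul_le_mul_right _ (le_trans ?_ hi)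
      exact IsHomogeneous.totalDegree_le hp2
  have h1 : ∀ k, IsIntegral (truncAlg (invRing ρ) (q * s)) (b k : MvPolynomial ι F) := by
    intro k
    have h2 := sigma_integral (lowRep N ρ s b) (X k)
    rw [← hq] at h2
    refine integral_of_le key ?_
    obtain ⟨p, hp, hpk⟩ := h2
    let f : truncAlg (invRing (lowRep N ρ s b)) q →+*
      (truncAlg (invRing (lowRep N ρ s b)) q).map (lowMap N ρ s b) :=
      { toFun := fun t => ⟨lowMap N ρ s b t.1, t.1, t.2, rfl⟩
        map_one' := Subtype.ext (map_one _)
        map_mul' := fun _ _ => Subtype.ext (map_mul _ _ _)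
        map_zero' := Subtype.ext (map_zero _)
        map_add' := fun _ _ => Subtype.ext (map_add _ _ _) }
    refine ⟨p.map f, hp.map f, ?_⟩
    rw [Polynomial.eval₂_map]
    have h3 := congrArg (lowMap N ρ s b : MvPolynomial (Fin n) F →+* MvPolynomial ι F) hpk
    rw [Polynomial.hom_eval₂, map_zero] at h3
    have h4 : (lowMap N ρ s b : MvPolynomial (Fin n) F →+* MvPolynomial ι F) (X k) = b k := by
      simp [lowMap]
    rw [h4] at h3
    exact h3
  have h2 : lowInv N ρ s ≤ Subalgebra.toSubmodule (intCl (truncAlg (invRing ρ) (q * s))) := by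
    intro f hf
    have h3 : _ = f := low_sum N ρ s b ⟨f, hf⟩
    rw [← h3]
    exact Submodule.sum_mem _ fun k _ => Submodule.smul_mem _ _ (h1 k)
  have h3 : truncAlg (invRing (ρ.comp N.subtype)) s ≤
      intCl (truncAlg (invRing ρ) (q * s)) := by
    refine Algebra.adjoin_le ?_
    intro p hp
    simp only [Set.mem_iUnion] at hp
    obtain ⟨i, hi, hp1, hp2⟩ := hp
    refine h2 ⟨hp1, ?_⟩
    rw [SetLike.mem_coe, mem_restrictTotalDegree]
    exact (IsHomogeneous.totalDegree_le hp2).trans hi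
  intro i
  have h4 := sigma_integral (ρ.comp N.subtype) (X i)
  rw [← hs] at h4
  exact integral_mono (fun t ht => h3 ht) h4

end Main

/-- For a normal subgroup `N` of `G` and a `G`-module `V`,
`σ(G,V) ≤ σ(G/N) ⬝ σ(N,V)`. -/
theorem sigmaAlg_le_quotient_mul {F : Type*} [Field F] {G : Type*} [Group G] [Finite G]
    (hG : (Nat.card G : F) ≠ 0) (N : Subgroup G) [N.Normal]
    {ι : Type*} [Fintype ι] [DecidableEq ι] (ρ : Representation F G (ι → F)) :
    (sigmaAlg (invRing ρ) : ℕ∞) ≤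
      sigmaGrp F (G ⧸ N) * (sigmaAlg (invRing (ρ.comp N.subtype)) : ℕ∞) := by
  have : Module.Finite F (lowInv N ρ (sigmaAlg (invRing (ρ.comp N.subtype)))) :=
    Module.Finite.iff_fg.2 (Submodule.FG.of_le
      (Module.Finite.iff_fg.1 (inferInstance : Module.Finite F (restrictTotalDegree ι F
        (sigmaAlg (invRing (ρ.comp N.subtype)))))) inf_le_right)
  have h := main_bound N ρ _ (Module.finBasis F _) rfl
  refine (Nat.cast_le.2 h).trans ?_
  rw [Nat.cast_mul]
  refine mul_le_mul_left ?_ _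
  exact le_iSup₂_of_le (f := fun (n : ℕ) (ρ : Representation F (G ⧸ N) (Fin n → F)) =>
    (sigmaAlg (invRing ρ) : ℕ∞)) _ _ le_rfl
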